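/- Define Φ̃(x) = x·ln(ln(x + e)) for x ≥ 0 and let Φ : [0,∞) → [0,∞) be its complementary Young function, Φ(x) = sup_{y≥0} (xy − Φ̃(y)). Then there exists a constant M' > 0 with the following property: for every t > 0 and every Bochner-integrable u : (0,t) → ℓ²(ℕ) (with components uₙ) whose Luxemburg norm N(u) := inf{ ρ > 0 : ∫₀ᵗ Φ(‖u(s)‖_{ℓ²}/ρ) ds ≤ 1 } is finite, one has Σ_{n=1}^∞ ( (2ⁿ/n) ∫₀ᵗ e^{−2ⁿ(t−s)} uₙ(s) ds )² ≤ (M')² N(u)². (This expresses that the diagonal operator B with Beₙ = (2ⁿ/n)eₙ is E_Φ-admissible for the diagonal semigroup with eigenvalues λₙ = −2ⁿ on ℓ².) -/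

import Mathlib

open MeasureTheory
open scoped ENNReal

/-- The Young function `Φ̃(x) = x·ln(ln(x+e))`. -/
noncomputable def PhiTilde (x : ℝ) : ℝ := x * Real.log (Real.log (x + Real.exp 1))

/-- The complementary Young function `Φ(x) = sup_{y ≥ 0} (xy − Φ̃(y))` of `Φ̃`. -/
noncomputable def PhiComp (x : ℝ) : ℝ :=
  sSup {z : ℝ | ∃ y : ℝ, 0 ≤ y ∧ z = x * y - PhiTilde y}

/-- The Luxemburg norm on `(0,t)` associated with the Young function `Φ = PhiComp`. -/
noncomputable def luxNorm (t : ℝ) (u : ℝ → lp (fun _ : ℕ => ℝ) 2) : ℝ :=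
  sInf {ρ : ℝ | 0 < ρ ∧
    (∫⁻ s in Set.Ioo 0 t, ENNReal.ofReal (PhiComp (‖u s‖ / ρ))) ≤ 1}

theorem log_log_add_exp_nonneg {y : ℝ} (hy : 0 ≤ y) :
    0 ≤ Real.log (Real.log (y + Real.exp 1)) := by
  apply Real.log_nonneg
  rw [Real.le_log_iff_exp_le (by positivity)]
  linarith

theorem bddAbove_PhiComp_set (x : ℝ) :
    BddAbove {z : ℝ | ∃ y : ℝ, 0 ≤ y ∧ z = x * y - PhiTilde y} := by
  refine ⟨|x| * Real.exp (Real.exp x), ?_⟩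
  rintro z ⟨y, hy, rfl⟩
  have hl := log_log_add_exp_nonneg hy
  unfold PhiTilde
  rcases le_total x (Real.log (Real.log (y + Real.exp 1))) with h | h
  · have : 0 ≤ |x| * Real.exp (Real.exp x) := by positivity
    nlinarith
  · have h1 : (1 : ℝ) ≤ Real.log (y + Real.exp 1) := by
      rw [Real.le_log_iff_exp_le (by positivity)]
      linarith
    have h2 := (Real.log_le_iff_le_exp (by linarith)).1 h
    have h3 := (Real.log_le_iff_le_exp (by positivity)).1 h2
    have h4 : y ≤ Real.exp (Real.exp x) := by linarith [Real.exp_pos 1]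
    have h5 : x * y ≤ |x| * Real.exp (Real.exp x) := by
      have := le_abs_self x
      gcongr
    nlinarith

/-- Young's inequality for the complementary pair. -/
theorem mul_sub_PhiTilde_le_PhiComp (x : ℝ) {y : ℝ} (hy : 0 ≤ y) :
    x * y - PhiTilde y ≤ PhiComp x :=
  le_csSup (bddAbove_PhiComp_set x) ⟨y, hy, rfl⟩

theorem PhiComp_nonneg (x : ℝ) : 0 ≤ PhiComp x := by
  simpa [PhiTilde] using mul_sub_PhiTilde_le_PhiComp x le_rfl

theorem monotone_PhiComp : Monotone PhiComp := by
  intro x x' h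
  refine csSup_le ⟨_, 0, le_rfl, rfl⟩ ?_
  rintro z ⟨y, hy, rfl⟩
  refine le_trans ?_ (mul_sub_PhiTilde_le_PhiComp x' hy)
  gcongr

/-- Where `x` is at least twice `ln(ln(1/r+e))`, the quotient `x/r` is controlled by `Φ(x)`. -/
theorem div_le_two_mul_PhiComp {x r : ℝ} (hr : 0 < r)
    (h : 2 * Real.log (Real.log (1 / r + Real.exp 1)) ≤ x) : x / r ≤ 2 * PhiComp x := by
  have h1 := mul_sub_PhiTilde_le_PhiComp x (y := 1 / r) (by positivity)
  have h2 : 1 / r * (2 * Real.log (Real.log (1 / r + Real.exp 1))) ≤ 1 / r * x := by gcongr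
  unfold PhiTilde at h1
  rw [div_eq_mul_one_div]
  linarith

theorem log_log_one_div_add_exp_le {m : ℕ} (hm : 1 ≤ m) {r : ℝ} (hr : 0 < r) :
    Real.log (Real.log (1 / r + Real.exp 1)) ≤
      Real.log m + 2 + 2 * (2 ^ m * r) ^ (-(1 / 2) : ℝ) := by
  have hm' : (1 : ℝ) ≤ m := by exact_mod_cast hm
  set τ : ℝ := 2 ^ m * r with hτ
  have hτ0 : 0 < τ := by positivity
  set x : ℝ := τ ^ (-(1 / 2) : ℝ) with hx
  have hx0 : 0 < x := by positivity
  have hx2 : x ^ 2 = 1 / τ := by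
    rw [hx, ← Real.rpow_natCast, ← Real.rpow_mul hτ0.le]
    norm_num
    exact Real.rpow_neg_one τ
  have hr' : 1 / r = 2 ^ m * x ^ 2 := by
    rw [hx2, hτ]
    field_simp
  have h2 : (2 : ℝ) ^ m ≤ Real.exp m := by
    rw [← mul_one (m : ℝ), Real.exp_nat_mul]
    gcongr
    linarith [Real.add_one_le_exp (1 : ℝ)]
  have h1 : (1 : ℝ) ≤ 2 ^ m := one_le_pow₀ (by norm_num)
  have hL1 : (1 : ℝ) ≤ Real.log (1 / r + Real.exp 1) := by
    rw [Real.le_log_iff_exp_le (by positivity)]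
    have : 0 < 1 / r := by positivity
    linarith
  have hL2 : Real.log (1 / r + Real.exp 1) ≤ m * Real.exp (2 * (1 + x)) := by
    rw [Real.log_le_iff_le_exp (by positivity), hr']
    have h3 : x ^ 2 + Real.exp 1 ≤ Real.exp (1 + x ^ 2) := by
      rw [Real.exp_add]
      nlinarith [Real.add_one_le_exp (x ^ 2), Real.add_one_le_exp (1 : ℝ), sq_nonneg x]
    calc 2 ^ m * x ^ 2 + Real.exp 1 ≤ 2 ^ m * (x ^ 2 + Real.exp 1) := by
          nlinarith [Real.exp_pos 1]
      _ ≤ Real.exp m * Real.exp (1 + x ^ 2) := by gcongr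
      _ = Real.exp (m + (1 + x ^ 2)) := by rw [← Real.exp_add]
      _ ≤ Real.exp (m * Real.exp (2 * (1 + x))) := by
          gcongr
          have h4 : (2 + x) ^ 2 ≤ Real.exp (2 * (1 + x)) := by
            rw [mul_comm, Real.exp_mul, Real.rpow_two]
            gcongr
            linarith [Real.add_one_le_exp (1 + x)]
          have h5 : (m : ℝ) * (2 + x) ^ 2 ≤ m * Real.exp (2 * (1 + x)) := by gcongr
          nlinarith [sq_nonneg x]
  calc Real.log (Real.log (1 / r + Real.exp 1))
      ≤ Real.log (m * Real.exp (2 * (1 + x))) := Real.log_le_log (by linarith) hL2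
    _ = Real.log m + 2 + 2 * x := by
      rw [Real.log_mul (by positivity) (by positivity), Real.log_exp]
      ring

/-- The exponential kernel of mass one and rate `K`, weighted by a function of `K * r` with an
integrable singularity at the origin. -/
noncomputable def weightedKernel (K A r : ℝ) : ℝ :=
  K * Real.exp (-(K * r)) * (A + 2 * (K * r) ^ (-(1 / 2) : ℝ))

theorem weightedKernel_nonneg {K A r : ℝ} (hK : 0 ≤ K) (hA : 0 ≤ A) (hr : 0 ≤ r) :
    0 ≤ weightedKernel K A r := by
  unfold weightedKernel
  positivity

theorem weightedKernel_integral_Ioi {K A : ℝ} (hK : 0 < K) :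
    IntegrableOn (weightedKernel K A) (Set.Ioi 0) ∧
      ∫ r in Set.Ioi 0, weightedKernel K A r = A + 2 * √Real.pi := by
  have e1 := Real.integral_rpow_mul_exp_neg_mul_Ioi one_pos hK
  have e2 := Real.integral_rpow_mul_exp_neg_mul_Ioi one_half_pos hK
  have i1 : IntegrableOn (fun x : ℝ ↦ x ^ ((1 : ℝ) - 1) * Real.exp (-(K * x))) (Set.Ioi 0) :=
    .of_integral_ne_zero (by rw [e1]; positivity)
  have i2 : IntegrableOn (fun x : ℝ ↦ x ^ ((1 / 2 : ℝ) - 1) * Real.exp (-(K * x))) (Set.Ioi 0) :=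
    .of_integral_ne_zero (by rw [e2]; positivity)
  have heq : Set.EqOn (fun x : ℝ ↦ (K * A) * (x ^ ((1 : ℝ) - 1) * Real.exp (-(K * x))) +
      (2 * K * K ^ (-(1 / 2) : ℝ)) * (x ^ ((1 / 2 : ℝ) - 1) * Real.exp (-(K * x))))
      (weightedKernel K A) (Set.Ioi 0) := by
    intro x hx
    have hx0 : (0 : ℝ) < x := hx
    simp only [weightedKernel]
    rw [Real.mul_rpow hK.le hx0.le, sub_self, Real.rpow_zero,
      show ((1 / 2 : ℝ) - 1) = -(1 / 2) by norm_num]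
    ring
  refine ⟨IntegrableOn.congr_fun ((i1.const_mul _).add (i2.const_mul _)) heq measurableSet_Ioi, ?_⟩
  rw [← setIntegral_congr_fun measurableSet_Ioi heq,
    integral_add (i1.const_mul _) (i2.const_mul _), integral_const_mul, integral_const_mul, e1, e2,
    Real.Gamma_one, Real.Gamma_one_half_eq, Real.rpow_one, one_div, Real.inv_rpow hK.le,
    ← Real.rpow_neg hK.le]
  have hK' : K ^ (-(1 / 2) : ℝ) * K ^ (-(1 / 2) : ℝ) = K⁻¹ := by
    rw [← Real.rpow_add hK, ← Real.rpow_neg_one]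
    norm_num
  norm_num at hK' ⊢
  linear_combination (2 * K * √Real.pi) * hK' + (A + 2 * √Real.pi) * mul_inv_cancel₀ hK.ne'

theorem weightedKernel_integral_reflect {K A t : ℝ} (hK : 0 < K) (hA : 0 ≤ A) (ht : 0 < t) :
    IntegrableOn (fun s ↦ weightedKernel K A (t - s)) (Set.Ioo 0 t) ∧
      ∫ s in Set.Ioo 0 t, weightedKernel K A (t - s) ≤ A + 4 := by
  obtain ⟨hi, he⟩ := weightedKernel_integral_Ioi (A := A) hK
  have hii : IntervalIntegrable (weightedKernel K A) volume 0 t := by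
    rw [intervalIntegrable_iff_integrableOn_Ioc_of_le ht.le]
    exact hi.mono_set Set.Ioc_subset_Ioi_self
  constructor
  · have := (hii.comp_sub_left t).symm
    simp only [sub_self, sub_zero] at this
    rwa [intervalIntegrable_iff_integrableOn_Ioo_of_le ht.le] at this
  · rw [← integral_Ioc_eq_integral_Ioo, ← intervalIntegral.integral_of_le ht.le,
      intervalIntegral.integral_comp_sub_left, sub_self, sub_zero,
      intervalIntegral.integral_of_le ht.le]
    calc ∫ r in Set.Ioc 0 t, weightedKernel K A r
        ≤ ∫ r in Set.Ioi 0, weightedKernel K A r :=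
          setIntegral_mono_set hi
            ((ae_restrict_iff' measurableSet_Ioi).2 (ae_of_all _ fun r hr ↦
              weightedKernel_nonneg hK.le hA (le_of_lt hr)))
            Set.Ioc_subset_Ioi_self.eventuallyLE
      _ = A + 2 * √Real.pi := he
      _ ≤ A + 4 := by
        have : √Real.pi ≤ 2 := by
          rw [Real.sqrt_le_left (by norm_num)]
          linarith [Real.pi_lt_four]
        linarith

theorem summable_sq_log_div :
    Summable fun n : ℕ ↦ (2 * (Real.log ((n : ℝ) + 1) + 6) / ((n : ℝ) + 1)) ^ 2 := by
  have h := ((summable_nat_add_iff 1).2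
    (Real.summable_nat_rpow_inv.2 (by norm_num : (1 : ℝ) < 3 / 2))).mul_left 400
  refine Summable.of_nonneg_of_le (fun n ↦ sq_nonneg _) (fun n ↦ ?_) h
  push_cast
  set x : ℝ := (n : ℝ) + 1 with hx
  have hx1 : 1 ≤ x := by simp [hx]
  have hx0 : 0 < x := by linarith
  have h1 : Real.log x ≤ 4 * x ^ (1 / 4 : ℝ) := by
    have := Real.log_le_rpow_div hx0.le (by norm_num : (0 : ℝ) < 1 / 4)
    linarith
  have h2 : (1 : ℝ) ≤ x ^ (1 / 4 : ℝ) := Real.one_le_rpow hx1 (by norm_num)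
  have h3 : 0 ≤ Real.log x := Real.log_nonneg hx1
  have h4 : x ^ (1 / 4 : ℝ) * x ^ (1 / 4 : ℝ) * x ^ (3 / 2 : ℝ) = x ^ 2 := by
    rw [← Real.rpow_add hx0, ← Real.rpow_add hx0, ← Real.rpow_two]
    norm_num
  calc (2 * (Real.log x + 6) / x) ^ 2 ≤ (2 * (10 * x ^ (1 / 4 : ℝ)) / x) ^ 2 := by
        gcongr
        linarith
    _ = 400 * (x ^ (3 / 2 : ℝ))⁻¹ := by
        have : x ^ (3 / 2 : ℝ) ≠ 0 := by positivity
        field_simp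
        linear_combination 400 * h4

theorem sum_shift_sq_le_norm_sq (f : lp (fun _ : ℕ => ℝ) 2) (N : ℕ) :
    ∑ n ∈ Finset.range N, f (n + 1) ^ 2 ≤ ‖f‖ ^ 2 := by
  have h := lp.sum_rpow_le_norm_rpow (p := 2) (by norm_num) f
    ((Finset.range N).map ⟨fun n ↦ n + 1, add_left_injective 1⟩)
  simpa using h

theorem mul_exp_neg_le_inv {K r : ℝ} (hr : 0 < r) : K * Real.exp (-K * r) ≤ 1 / r := by
  rw [le_div_iff₀ hr, neg_mul, Real.exp_neg]
  have h := Real.add_one_le_exp (K * r)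
  have := Real.exp_pos (K * r)
  field_simp
  linarith

/-- Pointwise bound behind the admissibility estimate: a finite combination of the kernels is
controlled by `Φ` where the input is large and by integrable kernels where it is small. -/
theorem sum_kernel_le (a : ℕ → ℝ) (N : ℕ) (f : lp (fun _ : ℕ => ℝ) 2) {ρ r : ℝ} (hρ : 0 < ρ)
    (hr : 0 < r) :
    ∑ n ∈ Finset.range N,
        a n * ((2 : ℝ) ^ (n + 1) / ((n : ℝ) + 1) * (Real.exp (-(2 : ℝ) ^ (n + 1) * r) * f (n + 1)))
      ≤ ρ * (2 * √(∑ n ∈ Finset.range N, a n ^ 2) * PhiComp (‖f‖ / ρ) +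
        ∑ n ∈ Finset.range N, |a n| * (2 / ((n : ℝ) + 1) *
          weightedKernel (2 ^ (n + 1)) (Real.log ((n : ℝ) + 1) + 2) r)) := by
  have hq : ∀ n : ℕ, 0 ≤ weightedKernel (2 ^ (n + 1)) (Real.log ((n : ℝ) + 1) + 2) r := fun n ↦
    weightedKernel_nonneg (by positivity)
      (add_nonneg (Real.log_nonneg (by simp)) (by norm_num)) hr.le
  have hterm : ∀ n : ℕ, a n * ((2 : ℝ) ^ (n + 1) / ((n : ℝ) + 1) *
      (Real.exp (-(2 : ℝ) ^ (n + 1) * r) * f (n + 1))) ≤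
      |a n| * ((2 : ℝ) ^ (n + 1) / ((n : ℝ) + 1) *
        (Real.exp (-(2 : ℝ) ^ (n + 1) * r) * |f (n + 1)|)) := fun n ↦ by
    refine (le_abs_self _).trans_eq ?_
    rw [abs_mul, abs_mul, abs_mul, abs_of_pos (Real.exp_pos _),
      abs_of_nonneg (by positivity : (0 : ℝ) ≤ (2 : ℝ) ^ (n + 1) / ((n : ℝ) + 1))]
  refine (Finset.sum_le_sum fun n _ ↦ hterm n).trans ?_
  rcases le_total (2 * Real.log (Real.log (1 / r + Real.exp 1))) (‖f‖ / ρ) with h | h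
  · have h1 : ∑ n ∈ Finset.range N, |a n| * |f (n + 1)| ≤
        √(∑ n ∈ Finset.range N, a n ^ 2) * ‖f‖ := by
      have := Real.sum_mul_le_sqrt_mul_sqrt (Finset.range N) (fun n ↦ |a n|)
        (fun n ↦ |f (n + 1)|)
      simp only [sq_abs] at this
      refine this.trans ?_
      gcongr
      exact Real.sqrt_le_iff.2 ⟨norm_nonneg _, sum_shift_sq_le_norm_sq f N⟩
    have h2 := div_le_two_mul_PhiComp hr h
    have h3 : ‖f‖ * (1 / r) ≤ ρ * (2 * PhiComp (‖f‖ / ρ)) := by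
      calc ‖f‖ * (1 / r) = ρ * (‖f‖ / ρ / r) := by field_simp
        _ ≤ _ := by gcongr
    calc _ ≤ ∑ n ∈ Finset.range N, (|a n| * |f (n + 1)|) * (1 / r) := by
          refine Finset.sum_le_sum fun n _ ↦ ?_
          have h4 := mul_exp_neg_le_inv (K := 2 ^ (n + 1)) hr
          have h5 : (2 : ℝ) ^ (n + 1) / ((n : ℝ) + 1) ≤ 2 ^ (n + 1) :=
            div_le_self (by positivity) (by simp)
          calc _ ≤ |a n| * ((2 : ℝ) ^ (n + 1) *
                (Real.exp (-(2 : ℝ) ^ (n + 1) * r) * |f (n + 1)|)) := by gcongr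
            _ = (|a n| * |f (n + 1)|) *
                ((2 : ℝ) ^ (n + 1) * Real.exp (-(2 : ℝ) ^ (n + 1) * r)) := by ring
            _ ≤ _ := by gcongr
      _ = (∑ n ∈ Finset.range N, |a n| * |f (n + 1)|) * (1 / r) := by rw [Finset.sum_mul]
      _ ≤ √(∑ n ∈ Finset.range N, a n ^ 2) * ‖f‖ * (1 / r) := by gcongr
      _ ≤ √(∑ n ∈ Finset.range N, a n ^ 2) * (ρ * (2 * PhiComp (‖f‖ / ρ))) := by
          rw [mul_assoc]
          gcongr
      _ = ρ * (2 * √(∑ n ∈ Finset.range N, a n ^ 2) * PhiComp (‖f‖ / ρ) + 0) := by ring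
      _ ≤ _ := by
          gcongr
          exact Finset.sum_nonneg fun n _ ↦ mul_nonneg (abs_nonneg _)
            (mul_nonneg (by positivity) (hq n))
  · have hf : ∀ n : ℕ, |f (n + 1)| ≤
        ρ * (2 * (Real.log ((n : ℝ) + 1) + 2 + 2 * (2 ^ (n + 1) * r) ^ (-(1 / 2) : ℝ))) := by
      intro n
      have h1 := lp.norm_apply_le_norm (by norm_num : (2 : ℝ≥0∞) ≠ 0) f (n + 1)
      have h2 := log_log_one_div_add_exp_le (m := n + 1) (by omega) hr
      push_cast at h2
      rw [div_le_iff₀ hρ] at h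
      calc |f (n + 1)| ≤ ‖f‖ := h1
        _ ≤ ρ * (2 * Real.log (Real.log (1 / r + Real.exp 1))) := by linarith
        _ ≤ _ := by gcongr
    calc _ ≤ ∑ n ∈ Finset.range N, ρ * (|a n| * (2 / ((n : ℝ) + 1) *
          weightedKernel (2 ^ (n + 1)) (Real.log ((n : ℝ) + 1) + 2) r)) := by
          refine Finset.sum_le_sum fun n _ ↦ ?_
          calc _ ≤ |a n| * ((2 : ℝ) ^ (n + 1) / ((n : ℝ) + 1) *
                (Real.exp (-(2 : ℝ) ^ (n + 1) * r) * (ρ * (2 * (Real.log ((n : ℝ) + 1) + 2 +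
                  2 * (2 ^ (n + 1) * r) ^ (-(1 / 2) : ℝ)))))) := by
                gcongr
                exact hf n
            _ = _ := by
                unfold weightedKernel
                rw [neg_mul]
                ring
      _ = ρ * (0 + ∑ n ∈ Finset.range N, |a n| * (2 / ((n : ℝ) + 1) *
          weightedKernel (2 ^ (n + 1)) (Real.log ((n : ℝ) + 1) + 2) r)) := by
          rw [zero_add, Finset.mul_sum]
      _ ≤ _ := by
          gcongr
          exact mul_nonneg (by positivity) (PhiComp_nonneg _)

theorem PhiComp_integral_le_one {t ρ : ℝ} {u : ℝ → lp (fun _ : ℕ => ℝ) 2}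
    (hu : IntegrableOn u (Set.Ioo 0 t))
    (h : (∫⁻ s in Set.Ioo 0 t, ENNReal.ofReal (PhiComp (‖u s‖ / ρ))) ≤ 1) :
    IntegrableOn (fun s ↦ PhiComp (‖u s‖ / ρ)) (Set.Ioo 0 t) ∧
      ∫ s in Set.Ioo 0 t, PhiComp (‖u s‖ / ρ) ≤ 1 := by
  have hm : AEStronglyMeasurable (fun s ↦ PhiComp (‖u s‖ / ρ))
      (volume.restrict (Set.Ioo 0 t)) :=
    (monotone_PhiComp.measurable.comp_aemeasurable
      (hu.aestronglyMeasurable.norm.aemeasurable.div_const ρ)).aestronglyMeasurable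
  have h0 : 0 ≤ᵐ[volume.restrict (Set.Ioo 0 t)] fun s ↦ PhiComp (‖u s‖ / ρ) :=
    ae_of_all _ fun s ↦ PhiComp_nonneg _
  refine ⟨(lintegral_ofReal_ne_top_iff_integrable hm h0).1
    (h.trans_lt ENNReal.one_lt_top).ne, ?_⟩
  rw [integral_eq_lintegral_of_nonneg_ae h0 hm]
  exact ENNReal.toReal_le_of_le_ofReal zero_le_one (by simpa using h)

theorem integrableOn_kernel_mul {t : ℝ} {u : ℝ → lp (fun _ : ℕ => ℝ) 2}
    (hu : IntegrableOn u (Set.Ioo 0 t)) {K : ℝ} (hK : 0 ≤ K) (i : ℕ) :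
    IntegrableOn (fun s ↦ Real.exp (-K * (t - s)) * u s i) (Set.Ioo 0 t) := by
  have hui : IntegrableOn (fun s ↦ u s i) (Set.Ioo 0 t) :=
    (lp.evalCLM ℝ (fun _ : ℕ => ℝ) 2 i).integrable_comp hu
  refine Integrable.bdd_mul (c := 1) hui (by fun_prop) ?_
  refine (ae_restrict_iff' measurableSet_Ioo).2 (ae_of_all _ fun s hs ↦ ?_)
  rw [Real.norm_of_nonneg (Real.exp_pos _).le, Real.exp_le_one_iff]
  nlinarith [hs.2]

theorem sqrt_sum_sq_le {t ρ : ℝ} (ht : 0 < t) (hρ : 0 < ρ) {u : ℝ → lp (fun _ : ℕ => ℝ) 2}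
    (hu : IntegrableOn u (Set.Ioo 0 t))
    (h : (∫⁻ s in Set.Ioo 0 t, ENNReal.ofReal (PhiComp (‖u s‖ / ρ))) ≤ 1) (N : ℕ) :
    √(∑ n ∈ Finset.range N, ((2 : ℝ) ^ (n + 1) / ((n : ℝ) + 1) *
        ∫ s in Set.Ioo 0 t, Real.exp (-(2 : ℝ) ^ (n + 1) * (t - s)) * u s (n + 1)) ^ 2) ≤
      (2 + √(∑' n : ℕ, (2 * (Real.log ((n : ℝ) + 1) + 6) / ((n : ℝ) + 1)) ^ 2)) * ρ := by
  set a : ℕ → ℝ := fun n ↦ (2 : ℝ) ^ (n + 1) / ((n : ℝ) + 1) *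
    ∫ s in Set.Ioo 0 t, Real.exp (-(2 : ℝ) ^ (n + 1) * (t - s)) * u s (n + 1) with ha
  set c : ℕ → ℝ := fun n ↦ 2 * (Real.log ((n : ℝ) + 1) + 6) / ((n : ℝ) + 1) with hc
  change √(∑ n ∈ Finset.range N, a n ^ 2) ≤ (2 + √(∑' n : ℕ, c n ^ 2)) * ρ
  set R : ℝ := √(∑ n ∈ Finset.range N, a n ^ 2) with hR
  have hRsq : R * R = ∑ n ∈ Finset.range N, a n ^ 2 :=
    Real.mul_self_sqrt (Finset.sum_nonneg fun n _ ↦ sq_nonneg _)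
  obtain ⟨hΦi, hΦ⟩ := PhiComp_integral_le_one hu h
  have hq := fun n : ℕ ↦ weightedKernel_integral_reflect (K := 2 ^ (n + 1))
    (A := Real.log ((n : ℝ) + 1) + 2) (by positivity)
    (add_nonneg (Real.log_nonneg (by simp)) (by norm_num)) ht
  have hki := fun n : ℕ ↦ ((integrableOn_kernel_mul hu (K := 2 ^ (n + 1)) (by positivity)
    (n + 1)).const_mul ((2 : ℝ) ^ (n + 1) / ((n : ℝ) + 1))).const_mul (a n)
  have hqi := fun n : ℕ ↦ ((hq n).1.const_mul (2 / ((n : ℝ) + 1))).const_mul |a n|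
  have hsumi := integrable_finsetSum (Finset.range N) fun n _ ↦ hqi n
  have hle : R * R ≤ ρ * (2 * R * 1 + ∑ n ∈ Finset.range N, |a n| * c n) := by
    calc R * R = ∑ n ∈ Finset.range N, a n * a n := by simp only [hRsq, sq]
      _ = ∫ s in Set.Ioo 0 t, ∑ n ∈ Finset.range N, a n * ((2 : ℝ) ^ (n + 1) / ((n : ℝ) + 1) *
          (Real.exp (-(2 : ℝ) ^ (n + 1) * (t - s)) * u s (n + 1))) := by
          rw [integral_finsetSum _ fun n _ ↦ hki n]
          simp only [integral_const_mul, ha]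
      _ ≤ ∫ s in Set.Ioo 0 t, ρ * (2 * R * PhiComp (‖u s‖ / ρ) +
          ∑ n ∈ Finset.range N, |a n| * (2 / ((n : ℝ) + 1) *
            weightedKernel (2 ^ (n + 1)) (Real.log ((n : ℝ) + 1) + 2) (t - s))) :=
          setIntegral_mono_on (integrable_finsetSum _ fun n _ ↦ hki n)
            (((hΦi.const_mul (2 * R)).add hsumi).const_mul ρ) measurableSet_Ioo
            fun s hs ↦ sum_kernel_le a N (u s) hρ (sub_pos.2 hs.2)
      _ = ρ * (2 * R * (∫ s in Set.Ioo 0 t, PhiComp (‖u s‖ / ρ)) +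
          ∑ n ∈ Finset.range N, |a n| * (2 / ((n : ℝ) + 1) * ∫ s in Set.Ioo 0 t,
            weightedKernel (2 ^ (n + 1)) (Real.log ((n : ℝ) + 1) + 2) (t - s))) := by
          rw [integral_const_mul, integral_add (hΦi.const_mul (2 * R)) hsumi,
            integral_finsetSum _ fun n _ ↦ hqi n]
          simp only [integral_const_mul]
      _ ≤ _ := by
          gcongr with n
          calc _ ≤ 2 / ((n : ℝ) + 1) * (Real.log ((n : ℝ) + 1) + 2 + 4) := by
                gcongr
                exact (hq n).2
            _ = c n := by
                simp only [hc]
                ring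
  have hcs : ∑ n ∈ Finset.range N, |a n| * c n ≤ R * √(∑' n : ℕ, c n ^ 2) := by
    have := Real.sum_mul_le_sqrt_mul_sqrt (Finset.range N) (fun n ↦ |a n|) c
    simp only [sq_abs] at this
    refine this.trans ?_
    gcongr
    exact summable_sq_log_div.sum_le_tsum _ fun n _ ↦ sq_nonneg _
  have hR0 : 0 ≤ R := Real.sqrt_nonneg _
  rcases hR0.eq_or_lt with h0 | h0
  · rw [← h0]
    positivity
  · refine le_of_mul_le_mul_left ?_ h0
    calc R * R ≤ ρ * (2 * R * 1 + R * √(∑' n : ℕ, c n ^ 2)) := hle.trans (by gcongr)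
      _ = _ := by ring

/-- `E_Φ`-admissibility of the diagonal operator `Beₙ = (2ⁿ/n)eₙ` for the diagonal
semigroup with eigenvalues `λₙ = −2ⁿ` on `ℓ²`: there is a constant `M' > 0` bounding the
input-to-state maps in terms of the Luxemburg norm of the input. -/
theorem diagonal_EPhi_admissible :
    ∃ M' : ℝ, 0 < M' ∧
      ∀ t : ℝ, 0 < t → ∀ u : ℝ → lp (fun _ : ℕ => ℝ) 2,
        IntegrableOn u (Set.Ioo 0 t) →
        {ρ : ℝ | 0 < ρ ∧
          (∫⁻ s in Set.Ioo 0 t, ENNReal.ofReal (PhiComp (‖u s‖ / ρ))) ≤ 1}.Nonempty →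
        (∑' n : ℕ,
            ENNReal.ofReal (((2 : ℝ) ^ (n + 1) / ((n : ℝ) + 1) *
              ∫ s in Set.Ioo 0 t,
                Real.exp (-(2 : ℝ) ^ (n + 1) * (t - s)) * u s (n + 1)) ^ 2)) ≤
          ENNReal.ofReal (M' ^ 2 * luxNorm t u ^ 2) := by
  refine ⟨2 + √(∑' n : ℕ, (2 * (Real.log ((n : ℝ) + 1) + 6) / ((n : ℝ) + 1)) ^ 2),
    by positivity, fun t ht u hu hne ↦ ENNReal.tsum_le_of_sum_range_le fun N ↦ ?_⟩
  rw [← ENNReal.ofReal_sum_of_nonneg fun n _ ↦ sq_nonneg _, ← mul_pow]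
  refine ENNReal.ofReal_le_ofReal (Real.sqrt_le_left ?_ |>.1 ?_)
  · exact mul_nonneg (by positivity) (Real.sInf_nonneg fun ρ hρ ↦ hρ.1.le)
  · rw [← div_le_iff₀' (by positivity)]
    refine le_csInf hne fun ρ hρ ↦ ?_
    rw [div_le_iff₀' (by positivity)]
    exact sqrt_sum_sq_le ht hρ.1 hu hρ.2 N
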